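/- Let W ⊆ V⊗ℝ^ℓ be a linear subspace, let φ: W → V be any linear operator, and let α ∈ (0,1) satisfy α > −κ′(1)/log m. Then the bilinear trace inequality holds: there exists a constant C such that ∫_𝕋 |𝕀_α[F]| dν ≤ C·(sup_{n≥0, ω∈𝒜ℱ_n} m^{(1−α)n} ν(ω))·‖F‖_{L¹} for every finite nonnegative Borel measure ν on 𝕋 and every simple martingale F ∈ 𝕎. -/

import Mathlib

open MeasureTheory Finset

noncomputable section

namespace TracePaper

variable {ι : Type} [Fintype ι]
variable {E : Type} [AddCommGroup E] [Module ℝ E]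

/-- A martingale adapted to the `ι`-uniform filtration, recorded by its values on atoms:
`val n c` is the value of `F_n` on the atom determined by the digit string `c`. -/
structure Mart (ι : Type) [Fintype ι] (E : Type) [AddCommGroup E] [Module ℝ E] where
  val : (n : ℕ) → (Fin n → ι) → E
  avg_eq : ∀ (n : ℕ) (c : Fin n → ι),
    val n c = (Fintype.card ι : ℝ)⁻¹ • ∑ j : ι, val (n + 1) (Fin.snoc c j)

/-- The martingale difference `dF_{n+1}|_ω` on the atom `ω = c ∈ 𝒜ℱ_n`, as an element of
`V ⊗ E` (an `ι`-tuple with zero average). -/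
def diff (F : Mart ι E) (n : ℕ) (c : Fin n → ι) : ι → E :=
  fun j => F.val (n + 1) (Fin.snoc c j) - F.val n c

/-- `F ∈ 𝕎`: all martingale differences lie in `W`. -/
def MemSpace (W : Set (ι → E)) (F : Mart ι E) : Prop :=
  ∀ (n : ℕ) (c : Fin n → ι), diff F n c ∈ W

/-- A simple martingale: all but finitely many differences vanish. -/
def Simple (F : Mart ι E) : Prop :=
  ∃ N : ℕ, ∀ n, N ≤ n → ∀ c : Fin n → ι, diff F n c = 0

/-- Average of an `ι`-tuple. -/
def avg (X : ι → E) : E := (Fintype.card ι : ℝ)⁻¹ • ∑ j, X j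

/-- The set `𝕄^W` of admissible `0`-flat increments. -/
def MW (W : Set (ι → E)) : Set (ι → ℝ) :=
  {v | (∑ j, v j = 0) ∧ (∀ j, -1 ≤ v j) ∧ ∃ a : E, a ≠ 0 ∧ (fun j => v j • a) ∈ W}

/-- `κ_v(θ) = θ log((1/m) ∑_j |1+v_j|^{1/θ})`, extended by continuity at `θ = 0`. -/
def kappaV (ι : Type) [Fintype ι] (v : ι → ℝ) (θ : ℝ) : ℝ :=
  if θ = 0 then Real.log (⨆ j, |1 + v j|)
  else θ * Real.log ((Fintype.card ι : ℝ)⁻¹ * ∑ j, |1 + v j| ^ (1 / θ))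

/-- `κ(θ) = sup {κ_v(θ) : v ∈ 𝕄^W}`. -/
def kappa (W : Set (ι → E)) (θ : ℝ) : ℝ :=
  sSup {r | ∃ v ∈ MW W, r = kappaV ι v θ}

/-- `κ'(1) = inf { -(1/m) ∑_j (1+v_j) log(1+v_j) : v ∈ 𝕄^W }`. -/
def kprime1 (W : Set (ι → E)) : ℝ :=
  sInf {r | ∃ v ∈ MW W,
    r = -((Fintype.card ι : ℝ)⁻¹ * ∑ j, (1 + v j) * Real.log (1 + v j))}

/-- `W` is geometric (κ affine) with `α = -κ'(1)/log m`; equivalently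
`κ(θ) = α (log m)(1-θ)` on `[0,1]`. -/
def GeometricOfOrder (W : Set (ι → E)) (α : ℝ) : Prop :=
  ∀ θ ∈ Set.Icc (0 : ℝ) 1, kappa W θ = α * Real.log (Fintype.card ι) * (1 - θ)

/-- `w = v ⊗ a` is an extremal vector with support `H`. -/
def IsExtremal (W : Set (ι → E)) (α : ℝ) (w : ι → E) (H : Finset ι) : Prop :=
  w ∈ W ∧ ∃ a : E, a ≠ 0 ∧ (H.card : ℝ) = (Fintype.card ι : ℝ) ^ ((1 : ℝ) - α) ∧
    (∀ j ∈ H, w j = ((Fintype.card ι : ℝ) ^ α - 1) • a) ∧ ∀ j ∉ H, w j = -a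

/-- `φ` is a canceling operator. -/
def Canceling (W : Set (ι → E)) (α : ℝ) (φ : (ι → E) → ι → ℝ) : Prop :=
  ∀ (w : ι → E) (H : Finset ι), IsExtremal W α w H → ∀ j ∈ H, φ w j = 0

/-- `W` is a non-local space (of order `α`). -/
def NonLocal (W : Set (ι → E)) (α : ℝ) : Prop :=
  ∀ (w : ι → E) (H : Finset ι), IsExtremal W α w H →
    ∀ u ∈ W, ∀ b : E, (∀ j ∉ H, b + u j = 0) → ∃ c : ℝ, u = c • w

/-- The martingale transform `𝕀_α[F]`, as a function of the path `γ ∈ 𝕋`. -/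
def Ialpha (φ : (ι → E) → ι → ℝ) (α : ℝ) (F : Mart ι E) (γ : ℕ → ι) : ℝ :=
  ∑' n : ℕ, (Fintype.card ι : ℝ) ^ (-(α * n)) *
    φ (diff F n (fun i : Fin n => γ i)) (γ n)

/-- The cylinder (atom of `ℱ_n`) determined by the digit string `c`. -/
def cyl (n : ℕ) (c : Fin n → ι) : Set (ℕ → ι) := {γ | ∀ i : Fin n, γ i = c i}

/-- The Borel σ-algebra of `𝕋` (= the product σ-algebra). -/
def treeMS (ι : Type) : MeasurableSpace (ℕ → ι) :=
  @MeasurableSpace.pi ℕ (fun _ => ι) (fun _ => ⊤)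

section Normed
variable {E' : Type} [NormedAddCommGroup E'] [NormedSpace ℝ E']

/-- `‖F‖_{L¹} = sup_n 𝔼 |F_n|`. -/
def L1Norm (F : Mart ι E') : ℝ :=
  ⨆ n : ℕ, ((Fintype.card ι : ℝ) ^ n)⁻¹ * ∑ c : Fin n → ι, ‖F.val n c‖

/-- The bilinear trace inequality
`∫_𝕋 |𝕀_α[F]| dν ≲ (sup_{n,ω} m^{(1-α)n} ν(ω)) ‖F‖_{L¹}`. -/
def TraceIneq (W : Set (ι → E')) (φ : (ι → E') → ι → ℝ) (α : ℝ) : Prop :=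
  ∃ C : ℝ, ∀ ν : @Measure (ℕ → ι) (treeMS ι), IsFiniteMeasure ν →
    ∀ F : Mart ι E', MemSpace W F → Simple F →
      ∀ A : ℝ,
        (∀ (n : ℕ) (c : Fin n → ι),
          (Fintype.card ι : ℝ) ^ (((1 : ℝ) - α) * n) * (ν (cyl n c)).toReal ≤ A) →
        ∫ γ, |Ialpha φ α F γ| ∂ν ≤ C * A * L1Norm F

/-- The Bellman main inequality for `G` on the Bellman domain. -/
def MainInequality (W : Set (ι → E')) (φ : (ι → E') → ι → ℝ) (α : ℝ)
    (G : E' → ℝ → ℝ → ℝ → ℝ → ℝ) : Prop :=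
  ∀ (X : ι → E') (y : ℝ) (Z T S : ι → ℝ),
    (∀ j, ‖X j‖ ≤ Z j) → (∀ j, 0 ≤ T j) → (∀ j, T j ≤ S j) →
    (fun j => X j - avg X) ∈ W →
    (Fintype.card ι : ℝ) ^ (-α) *
        ∑ j, G (X j) ((Fintype.card ι : ℝ) ^ α * y + φ (fun i => X i - avg X) j)
          (Z j) (T j) (S j)
      ≤ G (avg X) y ((Fintype.card ι : ℝ)⁻¹ * ∑ j, Z j) (∑ j, T j)
          (max (∑ j, T j) ((Fintype.card ι : ℝ) ^ ((1 : ℝ) - α) * ⨆ j, S j))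

/-- The boundary inequality `G(x, y, |x|, t, s) ≥ |y| t`. -/
def BoundaryIneq (G : E' → ℝ → ℝ → ℝ → ℝ → ℝ) : Prop :=
  ∀ (x : E') (y t s : ℝ), 0 ≤ t → t ≤ s → |y| * t ≤ G x y ‖x‖ t s

/-- A supersolution: main inequality + boundary inequality. -/
def Supersolution (W : Set (ι → E')) (φ : (ι → E') → ι → ℝ) (α : ℝ)
    (G : E' → ℝ → ℝ → ℝ → ℝ → ℝ) : Prop :=
  MainInequality W φ α G ∧ BoundaryIneq G

end Normed
theorem exp_quad {y : ℝ} (hy : y ≤ 1) : Real.exp y ≤ 1 + y + y ^ 2 := by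
  rcases le_or_gt (-1) y with h | h
  · have := Real.abs_exp_sub_one_sub_id_le (abs_le.2 ⟨h, hy⟩)
    have := (abs_le.1 this).2
    linarith
  · have : Real.exp y ≤ 1 := Real.exp_le_one_iff.2 (by linarith)
    nlinarith

theorem mul_logsq {u M : ℝ} (hu : 0 ≤ u) (huM : u ≤ M) :
    u * Real.log u ^ 2 ≤ 4 + M * Real.log M ^ 2 := by
  have hM : 0 ≤ M := hu.trans huM
  have hp : 0 ≤ M * Real.log M ^ 2 := by positivity
  rcases hu.eq_or_lt with h | h
  · rw [← h]; simp; linarith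
  rcases le_or_gt u 1 with h1 | h1
  · have h2 := Real.abs_log_mul_self_rpow_lt u (1/2) h h1 (by norm_num)
    have h3 : u * Real.log u ^ 2 = (Real.log u * u ^ (1/2 : ℝ)) ^ 2 := by
      rw [mul_pow, ← Real.rpow_natCast (u ^ (1/2 : ℝ)), ← Real.rpow_mul hu]; norm_num; ring
    rw [h3, ← sq_abs]
    have := abs_nonneg (Real.log u * u ^ (1/2 : ℝ))
    nlinarith
  · have h2 : 0 ≤ Real.log u := Real.log_nonneg h1.le
    have h3 : Real.log u ≤ Real.log M := Real.log_le_log h huM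
    have : u * Real.log u ^ 2 ≤ M * Real.log M ^ 2 := by gcongr
    linarith

theorem rpow_quad {u M t : ℝ} (hu : 0 ≤ u) (huM : u ≤ M) (ht : 0 < t) (htM : t * Real.log M ≤ 1) :
    u ^ (1 + t) ≤ u + t * (u * Real.log u) + t ^ 2 * (4 + M * Real.log M ^ 2) := by
  have hb := mul_logsq hu huM
  rcases hu.eq_or_lt with h | h
  · have hM : 0 ≤ M := hu.trans huM
    rw [← h, Real.zero_rpow (by linarith)]; simp; positivity
  have h1 : t * Real.log u ≤ 1 := le_trans (by gcongr) htM
  have h2 := exp_quad h1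
  have : u ^ (1 + t) = u * Real.exp (t * Real.log u) := by
    rw [Real.rpow_add h, Real.rpow_one, Real.rpow_def_of_pos h, mul_comm t]
  rw [this]
  have h3 := mul_le_mul_of_nonneg_left h2 hu
  have h4 := mul_le_mul_of_nonneg_left hb (sq_nonneg t)
  nlinarith

theorem compact_dom {X : Type*} [TopologicalSpace X] {K : Set X} (hK : IsCompact K)
    {L g : X → ℝ} (hL : Continuous L) (hg : Continuous g) (hg0 : ∀ x ∈ K, 0 ≤ g x)
    (hz : ∀ x ∈ K, g x = 0 → L x < 0) : ∃ C : ℝ, 0 ≤ C ∧ ∀ x ∈ K, L x ≤ C * g x := by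
  have hK' : IsCompact (K ∩ {x | 0 ≤ L x}) := hK.inter_right (isClosed_le continuous_const hL)
  rcases (K ∩ {x | 0 ≤ L x}).eq_empty_or_nonempty with he | hne
  · refine ⟨0, le_rfl, fun x hx => ?_⟩
    by_contra h
    have : x ∈ K ∩ {x | 0 ≤ L x} := ⟨hx, by simp at h ⊢; linarith⟩
    simp [he] at this
  · obtain ⟨a, ha, hamin⟩ := hK'.exists_isMinOn hne hg.continuousOn
    obtain ⟨b, hb, hbmax⟩ := hK'.exists_isMaxOn hne hL.continuousOn
    have hga : 0 < g a := lt_of_le_of_ne (hg0 a ha.1) fun h => by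
      have := hz a ha.1 h.symm
      have h2 : 0 ≤ L a := ha.2
      linarith
    have hLb : 0 ≤ L b := hb.2
    refine ⟨L b / g a, by positivity, fun x hx => ?_⟩
    rcases lt_or_ge (L x) 0 with h | h
    · have := hg0 x hx
      exact h.le.trans (by positivity)
    · have h1 : g a ≤ g x := hamin ⟨hx, h⟩
      have h2 : L x ≤ L b := hbmax ⟨hx, h⟩
      calc L x ≤ L b := h2
        _ = L b / g a * g a := by field_simp
        _ ≤ _ := by gcongr

theorem MW_bound (m ℓ : ℕ) (hm : 2 ≤ m)
    (W : Submodule ℝ (Fin m → EuclideanSpace ℝ (Fin ℓ))) (b : ℝ)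
    (hb : -(kprime1 (W : Set (Fin m → EuclideanSpace ℝ (Fin ℓ)))) < b) :
    ∃ t : ℝ, 0 < t ∧ ∀ v ∈ MW (W : Set (Fin m → EuclideanSpace ℝ (Fin ℓ))),
      (m : ℝ)⁻¹ * ∑ j, (1 + v j) ^ (1 + t) ≤ Real.exp (t * b) := by
  have hm0 : (0 : ℝ) < m := by positivity
  have hm1 : (1 : ℝ) < m := by exact_mod_cast hm
  have hlm : 0 < Real.log m := Real.log_pos hm1
  have hsum : ∀ v ∈ MW (W : Set (Fin m → EuclideanSpace ℝ (Fin ℓ))), ∑ j, (1 + v j) = m := by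
    intro v hv
    rw [Finset.sum_add_distrib, hv.1]; simp
  have hle : ∀ v ∈ MW (W : Set (Fin m → EuclideanSpace ℝ (Fin ℓ))), ∀ j, 1 + v j ≤ m := by
    intro v hv j
    rw [← hsum v hv]
    exact Finset.single_le_sum (f := fun j => 1 + v j)
      (fun i _ => by have := hv.2.1 i; linarith) (Finset.mem_univ j)
  have hbdd : BddBelow {r | ∃ v ∈ MW (W : Set (Fin m → EuclideanSpace ℝ (Fin ℓ))),
      r = -((Fintype.card (Fin m) : ℝ)⁻¹ * ∑ j, (1 + v j) * Real.log (1 + v j))} := by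
    refine ⟨-Real.log m, ?_⟩
    rintro r ⟨v, hv, rfl⟩
    have h1 : ∑ j, (1 + v j) * Real.log (1 + v j) ≤ ∑ j, (1 + v j) * Real.log m := by
      refine Finset.sum_le_sum fun j _ => ?_
      have h0 : 0 ≤ 1 + v j := by have := hv.2.1 j; linarith
      rcases h0.eq_or_lt with h | h
      · rw [← h]; simp
      · exact mul_le_mul_of_nonneg_left (Real.log_le_log h (hle v hv j)) h0
    rw [← Finset.sum_mul, hsum v hv] at h1
    rw [Fintype.card_fin, neg_le_neg_iff, inv_mul_le_iff₀ hm0]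
    exact h1
  set β := -(kprime1 (W : Set (Fin m → EuclideanSpace ℝ (Fin ℓ)))) with hβ
  have hent : ∀ v ∈ MW (W : Set (Fin m → EuclideanSpace ℝ (Fin ℓ))),
      (m : ℝ)⁻¹ * ∑ j, (1 + v j) * Real.log (1 + v j) ≤ β := by
    intro v hv
    have := csInf_le hbdd ⟨v, hv, rfl⟩
    have h2 : kprime1 (W : Set (Fin m → EuclideanSpace ℝ (Fin ℓ))) = -β := by rw [hβ]; ring
    unfold kprime1 at h2
    rw [h2, Fintype.card_fin] at this
    linarith
  set K : ℝ := 4 + m * Real.log m ^ 2 with hK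
  have hKpos : 0 < K := by positivity
  refine ⟨min (1 / Real.log m) ((b - β) / K), ?_, ?_⟩
  · have : 0 < b - β := by linarith
    positivity
  set t := min (1 / Real.log m) ((b - β) / K) with ht
  have ht0 : 0 < t := by
    have : 0 < b - β := by linarith
    positivity
  have ht1 : t * Real.log m ≤ 1 := by
    rw [← le_div_iff₀ hlm]; exact min_le_left _ _
  have ht2 : t * K ≤ b - β := by
    rw [← le_div_iff₀ hKpos]; exact min_le_right _ _
  intro v hv
  have h1 : ∑ j, (1 + v j) ^ (1 + t) ≤
      ∑ j, ((1 + v j) + t * ((1 + v j) * Real.log (1 + v j)) + t ^ 2 * K) :=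
    Finset.sum_le_sum fun j _ => rpow_quad (by have := hv.2.1 j; linarith) (hle v hv j) ht0 ht1
  rw [Finset.sum_add_distrib, Finset.sum_add_distrib, hsum v hv, ← Finset.mul_sum] at h1
  simp only [Finset.sum_const, Finset.card_univ, Fintype.card_fin, nsmul_eq_mul] at h1
  have h2 := mul_le_mul_of_nonneg_left h1 (inv_nonneg.2 hm0.le)
  have h3 := mul_le_mul_of_nonneg_left (hent v hv) ht0.le
  have h4 : (m : ℝ)⁻¹ * (m + t * ∑ j, (1 + v j) * Real.log (1 + v j) + m * (t ^ 2 * K))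
      = 1 + t * ((m : ℝ)⁻¹ * ∑ j, (1 + v j) * Real.log (1 + v j)) + t * (t * K) := by
    field_simp
  have h5 := mul_le_mul_of_nonneg_left ht2 ht0.le
  have h6 := Real.add_one_le_exp (t * b)
  nlinarith

/-- The convexity gap. -/
def gap {m ℓ : ℕ} (x : EuclideanSpace ℝ (Fin ℓ)) (w : Fin m → EuclideanSpace ℝ (Fin ℓ)) : ℝ :=
  (m : ℝ)⁻¹ * ∑ j, ‖x + w j‖ - ‖x‖

theorem gap_nonneg {m ℓ : ℕ} (hm : 2 ≤ m) (x : EuclideanSpace ℝ (Fin ℓ))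
    (w : Fin m → EuclideanSpace ℝ (Fin ℓ)) (hw : ∑ j, w j = 0) : 0 ≤ gap x w := by
  have hm0 : (0 : ℝ) < m := by positivity
  unfold gap
  have h1 : ∑ j, (x + w j) = (m : ℝ) • x := by
    rw [Finset.sum_add_distrib, hw]; simp [Nat.cast_smul_eq_nsmul]
  have h2 := norm_sum_le Finset.univ (fun j => x + w j)
  rw [h1, norm_smul, Real.norm_of_nonneg hm0.le] at h2
  rw [sub_nonneg, le_inv_mul_iff₀ hm0]
  exact h2

theorem gap_zero {m ℓ : ℕ} (hm : 2 ≤ m)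
    (W : Submodule ℝ (Fin m → EuclideanSpace ℝ (Fin ℓ)))
    (hWV : ∀ w ∈ W, ∑ j, w j = 0)
    (x : EuclideanSpace ℝ (Fin ℓ)) (hx : x ≠ 0)
    (w : Fin m → EuclideanSpace ℝ (Fin ℓ)) (hw : w ∈ W) (hg : gap x w = 0) :
    (fun j => ‖x + w j‖ / ‖x‖ - 1) ∈ MW (W : Set (Fin m → EuclideanSpace ℝ (Fin ℓ))) := by
  have hm0 : (0 : ℝ) < m := by positivity
  have hx0 : 0 < ‖x‖ := norm_pos_iff.2 hx
  have hs : ∑ j, ‖x + w j‖ = m * ‖x‖ := by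
    unfold gap at hg
    rw [sub_eq_zero, inv_mul_eq_iff_eq_mul₀ hm0.ne'] at hg
    exact hg
  have h1 : ∑ j, (x + w j) = (m : ℝ) • x := by
    rw [Finset.sum_add_distrib, hWV w hw]; simp [Nat.cast_smul_eq_nsmul]
  have h2 : ∑ j, (‖x‖ * ‖x + w j‖ - inner ℝ x (x + w j)) = 0 := by
    rw [Finset.sum_sub_distrib, ← Finset.mul_sum, hs, ← inner_sum, h1, inner_smul_right,
      real_inner_self_eq_norm_sq]
    ring
  have h3 : ∀ j, inner ℝ x (x + w j) = ‖x‖ * ‖x + w j‖ := by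
    intro j
    have := (Finset.sum_eq_zero_iff_of_nonneg (fun j _ =>
      sub_nonneg.2 (real_inner_le_norm x (x + w j)))).1 h2 j (Finset.mem_univ j)
    linarith
  have h4 : ∀ j, (‖x + w j‖ / ‖x‖ - 1) • x = w j := by
    intro j
    have h5 := inner_eq_norm_mul_iff_real.1 (h3 j)
    have h6 : (‖x + w j‖ / ‖x‖) • x = x + w j := by
      rw [div_eq_inv_mul, mul_smul, h5, smul_smul, inv_mul_cancel₀ hx0.ne', one_smul]
    rw [sub_smul, h6, one_smul]; abel
  refine ⟨?_, fun j => ?_, x, hx, ?_⟩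
  · rw [Finset.sum_sub_distrib, ← Finset.sum_div, hs]; field_simp; simp
  · have : 0 ≤ ‖x + w j‖ / ‖x‖ := by positivity
    simpa using this
  · simp only [h4]; exact hw

theorem lp_flat {m ℓ : ℕ} {t b : ℝ} (ht : 0 < t) {x : EuclideanSpace ℝ (Fin ℓ)}
    (hx0 : 0 < ‖x‖) (w : Fin m → EuclideanSpace ℝ (Fin ℓ))
    (h1 : (m : ℝ)⁻¹ * ∑ j, (‖x + w j‖ / ‖x‖) ^ (1 + t) ≤ Real.exp (t * b)) :
    ((m : ℝ)⁻¹ * ∑ j, ‖x + w j‖ ^ (1 + t)) ^ (1 / (1 + t)) ≤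
      Real.exp (t / (1 + t) * b) * ‖x‖ := by
  have hp : 0 < 1 + t := by linarith
  have h2 : (m : ℝ)⁻¹ * ∑ j, ‖x + w j‖ ^ (1 + t) =
      ((m : ℝ)⁻¹ * ∑ j, (‖x + w j‖ / ‖x‖) ^ (1 + t)) * ‖x‖ ^ (1 + t) := by
    rw [mul_assoc, Finset.sum_mul]
    congr 1
    refine Finset.sum_congr rfl fun j _ => ?_
    rw [← Real.mul_rpow (by positivity) (by positivity), div_mul_cancel₀ _ hx0.ne']
  calc ((m : ℝ)⁻¹ * ∑ j, ‖x + w j‖ ^ (1 + t)) ^ (1 / (1 + t))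
      ≤ (Real.exp (t * b) * ‖x‖ ^ (1 + t)) ^ (1 / (1 + t)) := by
        have hn : 0 ≤ (m : ℝ)⁻¹ * ∑ j, ‖x + w j‖ ^ (1 + t) :=
          mul_nonneg (inv_nonneg.2 (Nat.cast_nonneg m))
            (Finset.sum_nonneg fun j _ => Real.rpow_nonneg (norm_nonneg _) _)
        have hle : (m : ℝ)⁻¹ * ∑ j, ‖x + w j‖ ^ (1 + t) ≤ Real.exp (t * b) * ‖x‖ ^ (1 + t) := by
          rw [h2]
          exact mul_le_mul_of_nonneg_right h1 (Real.rpow_nonneg (norm_nonneg _) _)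
        exact Real.rpow_le_rpow hn hle (one_div_nonneg.2 hp.le)
    _ = _ := by
        rw [Real.mul_rpow (by positivity) (by positivity), ← Real.rpow_mul hx0.le,
          ← Real.exp_mul, mul_one_div_cancel hp.ne', Real.rpow_one]
        congr 2
        ring

/-- The dominated `L^p` estimate. -/
theorem lp_dom {m ℓ : ℕ} (hm : 2 ≤ m)
    (W : Submodule ℝ (Fin m → EuclideanSpace ℝ (Fin ℓ)))
    (hWV : ∀ w ∈ W, ∑ j, w j = 0) (t b b' : ℝ) (ht : 0 < t) (hbb : b < b')
    (hb : ∀ v ∈ MW (W : Set (Fin m → EuclideanSpace ℝ (Fin ℓ))),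
      (m : ℝ)⁻¹ * ∑ j, (1 + v j) ^ (1 + t) ≤ Real.exp (t * b)) :
    ∃ C : ℝ, 0 ≤ C ∧ ∀ x : EuclideanSpace ℝ (Fin ℓ), ∀ w ∈ W,
      ((m : ℝ)⁻¹ * ∑ j, ‖x + w j‖ ^ (1 + t)) ^ (1 / (1 + t)) ≤
        Real.exp (t / (1 + t) * b') * ‖x‖ + C * gap x w := by
  have hm0 : (0 : ℝ) < m := by positivity
  have hp : 0 < 1 + t := by linarith
  let K : Set (EuclideanSpace ℝ (Fin ℓ) × (Fin m → EuclideanSpace ℝ (Fin ℓ))) := Metric.sphere 0 1 ∩ {z | z.2 ∈ W}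
  have hK : IsCompact K := by
    refine (isCompact_sphere _ _).inter_right ?_
    exact (Submodule.closed_of_finiteDimensional W).preimage continuous_snd
  let N : (EuclideanSpace ℝ (Fin ℓ) × (Fin m → EuclideanSpace ℝ (Fin ℓ))) → ℝ := fun z => ((m : ℝ)⁻¹ * ∑ j, ‖z.1 + z.2 j‖ ^ (1 + t)) ^ (1 / (1 + t))
  let L : (EuclideanSpace ℝ (Fin ℓ) × (Fin m → EuclideanSpace ℝ (Fin ℓ))) → ℝ := fun z => N z - Real.exp (t / (1 + t) * b') * ‖z.1‖
  let g : (EuclideanSpace ℝ (Fin ℓ) × (Fin m → EuclideanSpace ℝ (Fin ℓ))) → ℝ := fun z => gap z.1 z.2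
  have hcN : Continuous N := by
    refine Continuous.rpow_const ?_ (fun _ => Or.inr (by positivity))
    refine continuous_const.mul (continuous_finsetSum _ fun j _ => ?_)
    refine Continuous.rpow_const ?_ (fun _ => Or.inr hp.le)
    fun_prop
  have hL : Continuous L := hcN.sub (by fun_prop)
  have hg : Continuous g := by
    unfold g gap
    fun_prop
  obtain ⟨C, hC, hdom⟩ := compact_dom hK hL hg
    (fun z hz => gap_nonneg hm _ _ (hWV _ hz.2)) (by
      rintro ⟨x, w⟩ ⟨hz1, hw⟩ hgz
      have hw : w ∈ W := hw
      have hgz : gap x w = 0 := hgz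
      have hx : x ≠ 0 := by
        rintro rfl
        have : w = 0 := by
          unfold gap at hgz
          simp only [zero_add, norm_zero, sub_zero, mul_eq_zero, inv_eq_zero, hm0.ne', false_or] at hgz
          rw [Finset.sum_eq_zero_iff_of_nonneg (fun _ _ => norm_nonneg _)] at hgz
          funext j
          simpa using hgz j (Finset.mem_univ j)
        subst this
        have h0 := mem_sphere_zero_iff_norm.1 hz1
        rw [Prod.mk_zero_zero, norm_zero] at h0
        exact zero_ne_one h0
      have hx0 : 0 < ‖x‖ := norm_pos_iff.2 hx
      have h1 := hb _ (gap_zero hm W hWV x hx w hw hgz)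
      simp only [add_sub_cancel] at h1
      have h3 : N (x, w) ≤ Real.exp (t / (1 + t) * b) * ‖x‖ := lp_flat ht hx0 w h1
      have h4 : Real.exp (t / (1 + t) * b) < Real.exp (t / (1 + t) * b') := by
        gcongr
      show N (x, w) - Real.exp (t / (1 + t) * b') * ‖x‖ < 0
      nlinarith)
  refine ⟨C, hC, fun x w hw => ?_⟩
  by_cases h0 : ((x, w) : (EuclideanSpace ℝ (Fin ℓ) × (Fin m → EuclideanSpace ℝ (Fin ℓ)))) = 0
  · have hx : x = 0 := congrArg Prod.fst h0
    have hw0 : w = 0 := congrArg Prod.snd h0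
    subst hx hw0
    simp [gap, Real.zero_rpow hp.ne', Real.zero_rpow (inv_pos.2 hp).ne']
  · set r := ‖((x, w) : (EuclideanSpace ℝ (Fin ℓ) × (Fin m → EuclideanSpace ℝ (Fin ℓ))))‖ with hr
    have hr0 : 0 < r := norm_pos_iff.2 h0
    have hz : (r⁻¹ • (x, w) : (EuclideanSpace ℝ (Fin ℓ) × (Fin m → EuclideanSpace ℝ (Fin ℓ)))) ∈ K := by
      refine ⟨?_, ?_⟩
      · rw [mem_sphere_zero_iff_norm, norm_smul, Real.norm_of_nonneg (by positivity), ← hr,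
          inv_mul_cancel₀ hr0.ne']
      · exact W.smul_mem _ hw
    have h1 := hdom _ hz
    have hn : ∀ y : EuclideanSpace ℝ (Fin ℓ), ‖r⁻¹ • y‖ = r⁻¹ * ‖y‖ := fun y => by
      rw [norm_smul, Real.norm_of_nonneg (by positivity)]
    have hgr : g (r⁻¹ • (x, w)) = r⁻¹ * gap x w := by
      show gap (r⁻¹ • x) (r⁻¹ • w) = _
      unfold gap
      simp only [Pi.smul_apply, ← smul_add, hn, ← Finset.mul_sum]
      ring
    have hNr : N (r⁻¹ • (x, w)) = r⁻¹ * N (x, w) := by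
      show ((m : ℝ)⁻¹ * ∑ j, ‖r⁻¹ • x + (r⁻¹ • w) j‖ ^ (1 + t)) ^ (1 / (1 + t)) =
        r⁻¹ * ((m : ℝ)⁻¹ * ∑ j, ‖x + w j‖ ^ (1 + t)) ^ (1 / (1 + t))
      have : ∀ j, ‖r⁻¹ • x + (r⁻¹ • w) j‖ ^ (1 + t) = (r⁻¹) ^ (1 + t) * ‖x + w j‖ ^ (1 + t) := by
        intro j
        rw [Pi.smul_apply, ← smul_add, hn, Real.mul_rpow (by positivity) (by positivity)]
      simp only [this, ← Finset.mul_sum]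
      rw [mul_left_comm, Real.mul_rpow (by positivity) (by positivity),
        ← Real.rpow_mul (by positivity), mul_one_div_cancel hp.ne', Real.rpow_one]
    have hLr : L (r⁻¹ • (x, w)) = r⁻¹ * (N (x, w) - Real.exp (t / (1 + t) * b') * ‖x‖) := by
      show N (r⁻¹ • (x, w)) - Real.exp (t / (1 + t) * b') * ‖r⁻¹ • x‖ = _
      rw [hNr, hn]; ring
    rw [hLr, hgr, mul_left_comm] at h1
    have h2 := le_of_mul_le_mul_left h1 (inv_pos.2 hr0)
    have h3 : N (x, w) ≤ Real.exp (t / (1 + t) * b') * ‖x‖ + C * gap x w := by linarith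
    exact h3

/-- One-step estimate. -/
theorem key_step {m ℓ : ℕ} (hm : 2 ≤ m)
    (W : Submodule ℝ (Fin m → EuclideanSpace ℝ (Fin ℓ)))
    (hWV : ∀ w ∈ W, ∑ j, w j = 0)
    (α : ℝ)
    (hα' : -(kprime1 (W : Set (Fin m → EuclideanSpace ℝ (Fin ℓ)))) / Real.log m < α) :
    ∃ s q C : ℝ, 0 < s ∧ s < 1 ∧ q < 1 ∧ 0 ≤ C ∧ ∀ x : EuclideanSpace ℝ (Fin ℓ), ∀ w ∈ W,
      ∀ (μ : Fin m → ℝ) (M : ℝ), (∀ j, 0 ≤ μ j) → 0 ≤ M →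
        ∑ j, μ j = (m : ℝ) ^ (1 - α) * M →
        (m : ℝ)⁻¹ * ∑ j, ‖x + w j‖ * μ j ^ s ≤ M ^ s * (q * ‖x‖ + C * gap x w) := by
  have hm0 : (0 : ℝ) < m := by positivity
  have hm1 : (1 : ℝ) < m := by exact_mod_cast hm
  have hlm : 0 < Real.log m := Real.log_pos hm1
  rw [div_lt_iff₀ hlm] at hα'
  obtain ⟨b, hb1, hb2⟩ := exists_between hα'
  obtain ⟨b', hb3, hb4⟩ := exists_between hb2
  obtain ⟨t, ht, hbt⟩ := MW_bound m ℓ hm W b hb1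
  obtain ⟨C, hC, hdom⟩ := lp_dom hm W hWV t b b' ht hb3 hbt
  have hp : 0 < 1 + t := by linarith
  set s := t / (1 + t) with hs
  have hs0 : 0 < s := by positivity
  have hs1 : s < 1 := by rw [hs, div_lt_one hp]; linarith
  have h1s : 1 / (1 + t) = 1 - s := by rw [hs]; field_simp; ring
  refine ⟨s, Real.exp (s * b') * (m : ℝ) ^ (-(α * s)), C * (m : ℝ) ^ (-(α * s)), hs0, hs1, ?_,
    by positivity, ?_⟩
  · rw [Real.rpow_def_of_pos hm0, ← Real.exp_add, Real.exp_lt_one_iff]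
    nlinarith
  intro x w hw μ M hμ hM hsum
  have hconj : (1 + t).HolderConjugate (1 / s) := by
    rw [Real.holderConjugate_iff]
    refine ⟨by linarith, ?_⟩
    rw [← one_div, h1s]; simp
  have hH := Real.inner_le_Lp_mul_Lq Finset.univ (fun j => ‖x + w j‖) (fun j => μ j ^ s) hconj
  have e1 : ∀ j, |μ j ^ s| ^ (1 / s) = μ j := fun j => by
    rw [abs_of_nonneg (Real.rpow_nonneg (hμ j) _), ← Real.rpow_mul (hμ j), mul_one_div_cancel hs0.ne',
      Real.rpow_one]
  simp only [e1, abs_norm, hsum, one_div_one_div] at hH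
  have e2 : (∑ j, ‖x + w j‖ ^ (1 + t)) ^ (1 / (1 + t)) =
      (m : ℝ) ^ (1 - s) * ((m : ℝ)⁻¹ * ∑ j, ‖x + w j‖ ^ (1 + t)) ^ (1 / (1 + t)) := by
    rw [← h1s, ← Real.mul_rpow hm0.le (by positivity), mul_inv_cancel_left₀ hm0.ne']
  rw [e2, Real.mul_rpow (by positivity) hM, ← Real.rpow_mul hm0.le] at hH
  have hd := hdom x w hw
  set P := ((m : ℝ)⁻¹ * ∑ j, ‖x + w j‖ ^ (1 + t)) ^ (1 / (1 + t)) with hP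
  have e3 : (m : ℝ)⁻¹ * ((m : ℝ) ^ (1 - s) * P * ((m : ℝ) ^ ((1 - α) * s) * M ^ s)) =
      (m : ℝ) ^ (-(α * s)) * M ^ s * P := by
    have : (m : ℝ) ^ (-(α * s)) = (m : ℝ)⁻¹ * (m : ℝ) ^ (1 - s) * (m : ℝ) ^ ((1 - α) * s) := by
      rw [← Real.rpow_neg_one, ← Real.rpow_add hm0, ← Real.rpow_add hm0]
      congr 1; ring
    rw [this]; ring
  calc (m : ℝ)⁻¹ * ∑ j, ‖x + w j‖ * μ j ^ s
      ≤ (m : ℝ)⁻¹ * ((m : ℝ) ^ (1 - s) * P * ((m : ℝ) ^ ((1 - α) * s) * M ^ s)) := by gcongr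
    _ = (m : ℝ) ^ (-(α * s)) * M ^ s * P := e3
    _ ≤ (m : ℝ) ^ (-(α * s)) * M ^ s * (Real.exp (s * b') * ‖x‖ + C * gap x w) := by gcongr
    _ = _ := by ring

theorem sum_snoc {m n : ℕ} (f : (Fin (n + 1) → Fin m) → ℝ) :
    ∑ c, f c = ∑ c : Fin n → Fin m, ∑ j, f (Fin.snoc c j) := by
  rw [← (Fin.snocEquiv (fun _ : Fin (n + 1) => Fin m)).sum_comp, Fintype.sum_prod_type,
    Finset.sum_comm]
  rfl

theorem tree_sum {m ℓ : ℕ} (hm : 2 ≤ m)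
    (W : Submodule ℝ (Fin m → EuclideanSpace ℝ (Fin ℓ)))
    (hWV : ∀ w ∈ W, ∑ j, w j = 0) (α s q C : ℝ) (hs0 : 0 < s) (hs1 : s < 1) (hq : q < 1)
    (hC : 0 ≤ C)
    (hkey : ∀ x : EuclideanSpace ℝ (Fin ℓ), ∀ w ∈ W,
      ∀ (μ : Fin m → ℝ) (M : ℝ), (∀ j, 0 ≤ μ j) → 0 ≤ M →
        ∑ j, μ j = (m : ℝ) ^ (1 - α) * M →
        (m : ℝ)⁻¹ * ∑ j, ‖x + w j‖ * μ j ^ s ≤ M ^ s * (q * ‖x‖ + C * gap x w))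
    (F : Mart (Fin m) (EuclideanSpace ℝ (Fin ℓ)))
    (hF : MemSpace (W : Set (Fin m → EuclideanSpace ℝ (Fin ℓ))) F)
    (mu : (n : ℕ) → (Fin n → Fin m) → ℝ) (A : ℝ)
    (hmu0 : ∀ n c, 0 ≤ mu n c) (hmuA : ∀ n c, mu n c ≤ A)
    (hadd : ∀ n c, ∑ j, mu (n + 1) (Fin.snoc c j) = (m : ℝ) ^ (1 - α) * mu n c) (N : ℕ) :
    ∑ n ∈ Finset.range N, ((m : ℝ) ^ n)⁻¹ * ∑ c : Fin n → Fin m, mu n c * ∑ j, ‖diff F n c j‖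
      ≤ m * (2 * (1 + C) / (1 - q) + 1) * A * (((m : ℝ) ^ N)⁻¹ * ∑ c, ‖F.val N c‖) := by
  have hm0 : (0 : ℝ) < m := by positivity
  have hA : 0 ≤ A := (hmu0 0 Fin.elim0).trans (hmuA 0 Fin.elim0)
  have hq' : 0 < 1 - q := by linarith
  set e : ℕ → ℝ := fun n => ((m : ℝ) ^ n)⁻¹ * ∑ c, ‖F.val n c‖ with he
  set U : ℕ → ℝ := fun n => ((m : ℝ) ^ n)⁻¹ * ∑ c, ‖F.val n c‖ * mu n c ^ s with hU
  have he0 : ∀ n, 0 ≤ e n := fun n => by positivity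
  have hU0 : ∀ n, 0 ≤ U n := fun n => by
    refine mul_nonneg (by positivity) (Finset.sum_nonneg fun c _ => ?_)
    exact mul_nonneg (norm_nonneg _) (Real.rpow_nonneg (hmu0 n c) _)
  have hkid : ∀ n (c : Fin n → Fin m) j,
      F.val (n + 1) (Fin.snoc c j) = F.val n c + diff F n c j := by
    intro n c j; simp [diff]
  have hgap0 : ∀ n (c : Fin n → Fin m), 0 ≤ gap (F.val n c) (diff F n c) := fun n c =>
    gap_nonneg hm _ _ (hWV _ (hF n c))
  have hpow : ∀ n : ℕ, ((m : ℝ) ^ (n + 1))⁻¹ = ((m : ℝ) ^ n)⁻¹ * (m : ℝ)⁻¹ := fun n => by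
    rw [pow_succ, mul_inv]
  have hegap : ∀ n, ((m : ℝ) ^ n)⁻¹ * ∑ c : Fin n → Fin m, gap (F.val n c) (diff F n c)
      = e (n + 1) - e n := by
    intro n
    simp only [he, hpow]
    rw [sum_snoc, mul_assoc, ← mul_sub]
    congr 1
    simp only [hkid, gap]
    rw [Finset.sum_sub_distrib, Finset.mul_sum]
  have hAs : 0 ≤ A ^ s := Real.rpow_nonneg hA _
  have hrec : ∀ n, U (n + 1) ≤ q * U n + C * A ^ s * (e (n + 1) - e n) := by
    intro n
    have h1 : U (n + 1) = ((m : ℝ) ^ n)⁻¹ * ∑ c : Fin n → Fin m,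
        ((m : ℝ)⁻¹ * ∑ j, ‖F.val n c + diff F n c j‖ * mu (n + 1) (Fin.snoc c j) ^ s) := by
      simp only [hU, hpow]
      rw [sum_snoc, mul_assoc, Finset.mul_sum]
      simp only [hkid]
    have h2 : q * U n + C * A ^ s * (e (n + 1) - e n) = ((m : ℝ) ^ n)⁻¹ * ∑ c : Fin n → Fin m,
        (q * (‖F.val n c‖ * mu n c ^ s) + C * A ^ s * gap (F.val n c) (diff F n c)) := by
      rw [← hegap, Finset.sum_add_distrib, ← Finset.mul_sum, ← Finset.mul_sum]
      simp only [hU]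
      ring
    rw [h1, h2]
    refine mul_le_mul_of_nonneg_left (Finset.sum_le_sum fun c _ => ?_) (by positivity)
    refine (hkey _ _ (hF n c) _ (mu n c) (fun j => hmu0 _ _) (hmu0 n c) (hadd n c)).trans ?_
    have h3 : mu n c ^ s ≤ A ^ s := Real.rpow_le_rpow (hmu0 n c) (hmuA n c) hs0.le
    have h4 := mul_le_mul_of_nonneg_right h3 (mul_nonneg hC (hgap0 n c))
    nlinarith
  have hUe0 : U 0 ≤ A ^ s * e 0 := by
    simp only [hU, he]
    rw [mul_left_comm (A ^ s), Finset.mul_sum (a := A ^ s)]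
    refine mul_le_mul_of_nonneg_left (Finset.sum_le_sum fun c _ => ?_) (by positivity)
    rw [mul_comm]
    exact mul_le_mul_of_nonneg_right (Real.rpow_le_rpow (hmu0 0 c) (hmuA 0 c) hs0.le)
      (norm_nonneg _)
  have hsumU : ∀ N, (1 - q) * ∑ n ∈ Finset.range N, U n + U N ≤
      A ^ s * e 0 + C * A ^ s * (e N - e 0) := by
    intro N
    induction N with
    | zero => simpa using hUe0
    | succ k ih =>
      rw [Finset.sum_range_succ]
      have := hrec k
      nlinarith
  have hemono : ∀ n, e n ≤ e (n + 1) := fun n => by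
    have h1 := hegap n
    have h2 : 0 ≤ ((m : ℝ) ^ n)⁻¹ * ∑ c : Fin n → Fin m, gap (F.val n c) (diff F n c) :=
      mul_nonneg (by positivity) (Finset.sum_nonneg fun c _ => hgap0 n c)
    linarith
  have heN : e 0 ≤ e N := monotone_nat_of_le_succ hemono (Nat.zero_le N)
  have hS : ∑ n ∈ Finset.range N, U n ≤ (1 + C) / (1 - q) * (A ^ s * e N) := by
    rw [div_mul_eq_mul_div, le_div_iff₀ hq']
    have h1 := hsumU N
    have h2 := hU0 N
    have h3 := mul_le_mul_of_nonneg_left heN hAs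
    have h4 := mul_nonneg (mul_nonneg hC hAs) (he0 0)
    nlinarith
  have hA1 : 0 ≤ A ^ (1 - s) := Real.rpow_nonneg hA _
  have hAA : A ^ (1 - s) * A ^ s = A := by
    rw [← Real.rpow_add_of_nonneg hA (by linarith) hs0.le]; simp
  have hterm : ∀ n, ((m : ℝ) ^ n)⁻¹ * ∑ c : Fin n → Fin m, mu n c * ∑ j, ‖diff F n c j‖ ≤
      m * (2 * A ^ (1 - s) * U n + A * (e (n + 1) - e n)) := by
    intro n
    have h2 : m * (2 * A ^ (1 - s) * U n + A * (e (n + 1) - e n)) =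
        ((m : ℝ) ^ n)⁻¹ * ∑ c : Fin n → Fin m, (m * (2 * A ^ (1 - s)) * (‖F.val n c‖ * mu n c ^ s)
          + m * A * gap (F.val n c) (diff F n c)) := by
      rw [← hegap, Finset.sum_add_distrib, ← Finset.mul_sum, ← Finset.mul_sum]
      simp only [hU]
      ring
    rw [h2]
    refine mul_le_mul_of_nonneg_left (Finset.sum_le_sum fun c _ => ?_) (by positivity)
    have hD : ∑ j, ‖diff F n c j‖ ≤ m * (2 * ‖F.val n c‖ + gap (F.val n c) (diff F n c)) := by
      have h3 : ∑ j, ‖diff F n c j‖ ≤ ∑ j, (‖F.val n c + diff F n c j‖ + ‖F.val n c‖) :=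
        Finset.sum_le_sum fun j _ => by
          have := norm_sub_le (F.val n c + diff F n c j) (F.val n c)
          simpa using this
      rw [Finset.sum_add_distrib] at h3
      simp only [Finset.sum_const, Finset.card_univ, Fintype.card_fin, nsmul_eq_mul] at h3
      refine h3.trans (le_of_eq ?_)
      unfold gap
      field_simp
      ring
    have hmus : mu n c ≤ A ^ (1 - s) * mu n c ^ s := by
      have h4 : mu n c = mu n c ^ (1 - s) * mu n c ^ s := by
        rw [← Real.rpow_add_of_nonneg (hmu0 n c) (by linarith) hs0.le]; simp
      calc mu n c = mu n c ^ (1 - s) * mu n c ^ s := h4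
        _ ≤ _ := mul_le_mul_of_nonneg_right
          (Real.rpow_le_rpow (hmu0 n c) (hmuA n c) (by linarith)) (Real.rpow_nonneg (hmu0 n c) _)
    calc mu n c * ∑ j, ‖diff F n c j‖
        ≤ mu n c * (m * (2 * ‖F.val n c‖ + gap (F.val n c) (diff F n c))) :=
          mul_le_mul_of_nonneg_left hD (hmu0 n c)
      _ = (m * 2 * ‖F.val n c‖) * mu n c + (m * gap (F.val n c) (diff F n c)) * mu n c := by ring
      _ ≤ (m * 2 * ‖F.val n c‖) * (A ^ (1 - s) * mu n c ^ s)
          + (m * gap (F.val n c) (diff F n c)) * A :=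
          add_le_add (mul_le_mul_of_nonneg_left hmus (by positivity))
            (mul_le_mul_of_nonneg_left (hmuA n c) (mul_nonneg hm0.le (hgap0 n c)))
      _ = _ := by ring
  calc _ ≤ ∑ n ∈ Finset.range N, m * (2 * A ^ (1 - s) * U n + A * (e (n + 1) - e n)) :=
        Finset.sum_le_sum fun n _ => hterm n
    _ = m * (2 * A ^ (1 - s) * ∑ n ∈ Finset.range N, U n + A * (e N - e 0)) := by
        rw [← Finset.mul_sum, Finset.sum_add_distrib, ← Finset.mul_sum, ← Finset.mul_sum,
          Finset.sum_range_sub]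
    _ ≤ m * (2 * A ^ (1 - s) * ((1 + C) / (1 - q) * (A ^ s * e N)) + A * e N) := by
        refine mul_le_mul_of_nonneg_left (add_le_add ?_ ?_) hm0.le
        · exact mul_le_mul_of_nonneg_left hS (by positivity)
        · exact mul_le_mul_of_nonneg_left (by linarith [he0 0]) hA
    _ = m * (2 * ((1 + C) / (1 - q)) * (A ^ (1 - s) * A ^ s) * e N + A * e N) := by ring
    _ = _ := by rw [hAA]; ring

theorem cyl_meas {m n : ℕ} (c : Fin n → Fin m) :
    @MeasurableSet _ (treeMS (Fin m)) (cyl n c) := by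
  letI : MeasurableSpace (Fin m) := ⊤
  have : cyl n c = ⋂ i : Fin n, (fun γ : ℕ → Fin m => γ i) ⁻¹' {c i} := by
    ext γ; simp [cyl]
  rw [this]
  exact MeasurableSet.iInter fun i => measurable_pi_apply (i : ℕ) trivial

theorem mem_cyl_snoc {m n : ℕ} (c : Fin n → Fin m) (j : Fin m) (γ : ℕ → Fin m) :
    γ ∈ cyl (n + 1) (Fin.snoc c j) ↔ γ ∈ cyl n c ∧ γ n = j := by
  simp [cyl, Fin.forall_fin_succ']

theorem cyl_add {m n : ℕ} (ν : @Measure (ℕ → Fin m) (treeMS (Fin m))) (hν : IsFiniteMeasure ν)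
    (c : Fin n → Fin m) :
    ∑ j, (ν (cyl (n + 1) (Fin.snoc c j))).toReal = (ν (cyl n c)).toReal := by
  letI := treeMS (Fin m)
  have h : cyl n c = ⋃ j, cyl (n + 1) (Fin.snoc c j) := by
    ext γ; simp [mem_cyl_snoc]
  rw [h, measure_iUnion _ (fun j => cyl_meas _), tsum_fintype,
    ENNReal.toReal_sum (fun j _ => measure_ne_top ν _)]
  intro i j hij
  refine Set.disjoint_left.2 fun γ h1 h2 => hij ?_
  rw [mem_cyl_snoc] at h1 h2
  exact h1.2.symm.trans h2.2

theorem int_cyl {m n : ℕ} (ν : @Measure (ℕ → Fin m) (treeMS (Fin m))) (hν : IsFiniteMeasure ν)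
    (f : (Fin n → Fin m) → ℝ) :
    Integrable (fun γ : ℕ → Fin m => f (fun i : Fin n => γ i)) ν ∧
    ∫ γ, f (fun i : Fin n => γ i) ∂ν = ∑ c, f c * (ν (cyl n c)).toReal := by
  letI := treeMS (Fin m)
  have h : (fun γ : ℕ → Fin m => f (fun i : Fin n => γ i)) =
      fun γ => ∑ c, (cyl n c).indicator (fun _ => f c) γ := by
    funext γ
    rw [Finset.sum_eq_single (fun i : Fin n => γ i)]
    · rw [Set.indicator_of_mem]; simp [cyl]
    · intro c _ hc
      refine Set.indicator_of_notMem (fun h => hc ?_) _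
      funext i; exact (h i).symm
    · simp
  have hi : ∀ c, Integrable ((cyl n c).indicator (fun _ => f c)) ν := fun c =>
    (integrable_const _).indicator (cyl_meas c)
  rw [h]
  refine ⟨integrable_finsetSum _ fun c _ => hi c, ?_⟩
  rw [integral_finsetSum _ fun c _ => hi c]
  refine Finset.sum_congr rfl fun c _ => ?_
  rw [integral_indicator_const _ (cyl_meas c), smul_eq_mul, mul_comm]
  rfl

theorem phi_bound {m ℓ : ℕ}
    (φ : (Fin m → EuclideanSpace ℝ (Fin ℓ)) →ₗ[ℝ] (Fin m → ℝ)) :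
    ∃ B : ℝ, 0 ≤ B ∧ ∀ w j, |φ w j| ≤ B * ∑ i, ‖w i‖ := by
  refine ⟨‖LinearMap.toContinuousLinearMap φ‖, norm_nonneg _, fun w j => ?_⟩
  have h1 : ‖w‖ ≤ ∑ i, ‖w i‖ :=
    (pi_norm_le_iff_of_nonneg (Finset.sum_nonneg fun i _ => norm_nonneg _)).2 fun i =>
      Finset.single_le_sum (f := fun i => ‖w i‖) (fun i _ => norm_nonneg _) (Finset.mem_univ i)
  have h2 := (LinearMap.toContinuousLinearMap φ).le_opNorm w
  have h3 := norm_le_pi_norm (φ w) j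
  exact h3.trans (h2.trans (mul_le_mul_of_nonneg_left h1 (norm_nonneg _)))

theorem L1_ge {m ℓ : ℕ} (hm : 2 ≤ m) (F : Mart (Fin m) (EuclideanSpace ℝ (Fin ℓ))) (N : ℕ)
    (hN : ∀ n, N ≤ n → ∀ c : Fin n → Fin m, diff F n c = 0) :
    ((m : ℝ) ^ N)⁻¹ * ∑ c, ‖F.val N c‖ ≤ L1Norm F := by
  have hm0 : (0 : ℝ) < m := by positivity
  unfold L1Norm
  rw [Fintype.card_fin]
  refine le_ciSup (f := fun n : ℕ => ((m : ℝ) ^ n)⁻¹ * ∑ c : Fin n → Fin m, ‖F.val n c‖) ?_ N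
  set e : ℕ → ℝ := fun n => ((m : ℝ) ^ n)⁻¹ * ∑ c : Fin n → Fin m, ‖F.val n c‖ with he
  have hconst : ∀ k, e (N + k) = e N := by
    intro k
    induction k with
    | zero => rfl
    | succ k ih =>
      rw [← ih]
      simp only [he]
      rw [← add_assoc, sum_snoc]
      have hkid : ∀ (c : Fin (N + k) → Fin m) j,
          F.val (N + k + 1) (Fin.snoc c j) = F.val (N + k) c := by
        intro c j
        have := congrFun (hN (N + k) (Nat.le_add_right _ _) c) j
        simpa [diff, sub_eq_zero] using this
      simp only [hkid, Finset.sum_const, Finset.card_univ, Fintype.card_fin, nsmul_eq_mul]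
      rw [← Finset.mul_sum, pow_succ]
      field_simp
  refine ⟨∑ n ∈ Finset.range (N + 1), e n, ?_⟩
  rintro r ⟨n, rfl⟩
  have he0 : ∀ n, 0 ≤ e n := fun n => by positivity
  have hle : ∀ n, n ≤ N → e n ≤ ∑ n ∈ Finset.range (N + 1), e n := fun n hn =>
    Finset.single_le_sum (fun i _ => he0 i) (Finset.mem_range.2 (by omega))
  rcases le_total n N with h | h
  · exact hle n h
  · obtain ⟨k, rfl⟩ := Nat.exists_eq_add_of_le h
    show e (N + k) ≤ _
    rw [hconst k]
    exact hle N le_rfl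

/-- subcritical trace theorem: if `α > -κ'(1)/log m`, the bilinear trace
inequality holds for any subspace `W` and any operator `φ`. -/
theorem statement1 (m ℓ : ℕ) (hm : 2 ≤ m) (hℓ : 1 ≤ ℓ)
    (W : Submodule ℝ (Fin m → EuclideanSpace ℝ (Fin ℓ)))
    (hWV : ∀ w ∈ W, ∑ j, w j = 0)
    (φ : (Fin m → EuclideanSpace ℝ (Fin ℓ)) →ₗ[ℝ] (Fin m → ℝ))
    (hφV : ∀ w ∈ W, ∑ j, φ w j = 0)
    (α : ℝ) (hα : α ∈ Set.Ioo (0 : ℝ) 1)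
    (hα' : -(kprime1 (W : Set (Fin m → EuclideanSpace ℝ (Fin ℓ)))) / Real.log m < α) :
    TraceIneq (W : Set (Fin m → EuclideanSpace ℝ (Fin ℓ))) (fun w => φ w) α := by
  have hm0 : (0 : ℝ) < m := by positivity
  obtain ⟨s, q, C, hs0, hs1, hq, hC, hkey⟩ := key_step hm W hWV α hα'
  obtain ⟨B, hB, hφ⟩ := phi_bound φ
  refine ⟨B * (m * (2 * (1 + C) / (1 - q) + 1)), ?_⟩
  intro ν hν F hF hsimple A hA
  obtain ⟨N, hN⟩ := hsimple
  rw [Fintype.card_fin] at hA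
  let mu : (n : ℕ) → (Fin n → Fin m) → ℝ := fun n c =>
    (m : ℝ) ^ ((1 - α) * n) * (ν (cyl n c)).toReal
  have hmu0 : ∀ n c, 0 ≤ mu n c := fun n c => by positivity
  have hadd : ∀ n c, ∑ j, mu (n + 1) (Fin.snoc c j) = (m : ℝ) ^ (1 - α) * mu n c := by
    intro n c
    simp only [mu]
    rw [← Finset.mul_sum, cyl_add ν hν, ← mul_assoc, ← Real.rpow_add hm0]
    congr 2
    push_cast
    ring
  have htree := tree_sum hm W hWV α s q C hs0 hs1 hq hC hkey F hF mu A hmu0 hA hadd N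
  have hA0 : 0 ≤ A := (hmu0 0 Fin.elim0).trans (hA 0 Fin.elim0)
  have hq' : 0 < 1 - q := by linarith
  have hL := L1_ge hm F N hN
  let D : (n : ℕ) → (Fin n → Fin m) → ℝ := fun n c =>
    (m : ℝ) ^ (-(α * n)) * (B * ∑ j, ‖diff F n c j‖)
  have hI : ∀ γ : ℕ → Fin m, |Ialpha (fun w => φ w) α F γ| ≤
      ∑ n ∈ Finset.range N, D n (fun i : Fin n => γ i) := by
    intro γ
    unfold Ialpha
    rw [tsum_eq_sum (s := Finset.range N)]
    · refine (Finset.abs_sum_le_sum_abs _ _).trans (Finset.sum_le_sum fun n _ => ?_)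
      rw [Fintype.card_fin, abs_mul, abs_of_nonneg (Real.rpow_nonneg hm0.le _)]
      exact mul_le_mul_of_nonneg_left (hφ _ _) (Real.rpow_nonneg hm0.le _)
    · intro n hn
      rw [hN n (by simpa using hn)]
      simp
  have hint : ∫ γ, |Ialpha (fun w => φ w) α F γ| ∂ν ≤
      ∫ γ, ∑ n ∈ Finset.range N, D n (fun i : Fin n => γ i) ∂ν := by
    refine integral_mono_of_nonneg (Filter.Eventually.of_forall fun γ => abs_nonneg _) ?_
      (Filter.Eventually.of_forall hI)
    exact integrable_finsetSum _ fun n _ => (int_cyl ν hν (D n)).1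
  rw [integral_finsetSum _ fun n _ => (int_cyl ν hν (D n)).1] at hint
  have heq : ∑ n ∈ Finset.range N, ∫ γ, D n (fun i : Fin n => γ i) ∂ν =
      B * ∑ n ∈ Finset.range N, ((m : ℝ) ^ n)⁻¹ *
        ∑ c : Fin n → Fin m, mu n c * ∑ j, ‖diff F n c j‖ := by
    rw [Finset.mul_sum]
    refine Finset.sum_congr rfl fun n _ => ?_
    rw [(int_cyl ν hν (D n)).2, Finset.mul_sum, Finset.mul_sum]
    refine Finset.sum_congr rfl fun c _ => ?_
    simp only [D, mu]
    have : (m : ℝ) ^ (-(α * n)) = ((m : ℝ) ^ n)⁻¹ * (m : ℝ) ^ ((1 - α) * n) := by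
      rw [← Real.rpow_natCast, ← Real.rpow_neg hm0.le, ← Real.rpow_add hm0]
      congr 1; ring
    rw [this]; ring
  rw [heq] at hint
  have hK : 0 ≤ m * (2 * (1 + C) / (1 - q) + 1) * A := by positivity
  calc _ ≤ _ := hint
    _ ≤ B * (m * (2 * (1 + C) / (1 - q) + 1) * A * L1Norm F) :=
        mul_le_mul_of_nonneg_left (htree.trans (mul_le_mul_of_nonneg_left hL hK)) hB
    _ = _ := by ring

end TracePaper
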